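/- arXiv:2601.16796 — 2 statements merged into one kernel-verified Lean document; each statement's English description precedes it below -/
import Mathlib

section
/- If f : [a,b] → ℝ is C^6 with f⁽⁶⁾ ≥ 0 on [a,b], then G[f;a,b] ≤ ∫_a^b f(x) dx ≤ (G[f;a,b] + L[f;a,b])/2. -/
open MeasureTheory intervalIntegral

noncomputable def gaussQ (f : ℝ → ℝ) (a b : ℝ) : ℝ :=
  (b - a) / 18 * (5 * f ((5 + Real.sqrt 15) / 10 * a + (5 - Real.sqrt 15) / 10 * b)
    + 8 * f ((a + b) / 2)
    + 5 * f ((5 - Real.sqrt 15) / 10 * a + (5 + Real.sqrt 15) / 10 * b))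

noncomputable def lobattoQ (f : ℝ → ℝ) (a b : ℝ) : ℝ :=
  (b - a) / 12 * (f a + 5 * f ((5 + Real.sqrt 5) / 10 * a + (5 - Real.sqrt 5) / 10 * b)
    + 5 * f ((5 - Real.sqrt 5) / 10 * a + (5 + Real.sqrt 5) / 10 * b) + f b)

noncomputable def quadQ (f : ℝ → ℝ) (a b : ℝ) : ℝ :=
  3 / 4 * gaussQ f a b + 1 / 4 * lobattoQ f a b

lemma kerA (u t : ℝ) (hu : u ^ 2 = 3 / 5) (hu0 : 0 ≤ u) (ht : t ≤ 1) :
    0 ≤ (1 - t) ^ 6 - 10 / 3 * (max (u - t) 0) ^ 5 := by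
  have hu1 : u ≤ 0.7746 := by nlinarith
  rcases le_total (u - t) 0 with h | h
  · rw [max_eq_right h]
    have : 0 ≤ (1 - t) ^ 6 := by positivity
    simpa using this
  · rw [max_eq_left h]
    obtain ⟨r, hr⟩ : ∃ r, r = (u - t) / 5 := ⟨_, rfl⟩
    obtain ⟨d, hd⟩ : ∃ d, d = 1 - u := ⟨_, rfl⟩
    have hr0 : 0 ≤ r := by rw [hr]; positivity
    have hd0 : 0.2254 ≤ d := by rw [hd]; linarith
    have h1 : 1 - t = 5 * r + d := by rw [hr, hd]; ring
    have h2 : u - t = 5 * r := by rw [hr]; ring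
    rw [h1, h2]
    have key : (5 * r + d) ^ 6 - 46656 * r ^ 5 * d
        = (r - d) ^ 2 * (15625 * r ^ 4 + 3344 * r ^ 3 * d + 438 * r ^ 2 * d ^ 2
          + 32 * r * d ^ 3 + d ^ 4) := by ring
    have : 0 ≤ (r - d) ^ 2 * (15625 * r ^ 4 + 3344 * r ^ 3 * d + 438 * r ^ 2 * d ^ 2
          + 32 * r * d ^ 3 + d ^ 4) := by
      have : 0 ≤ d := by linarith
      positivity
    have h5 : 0 ≤ r ^ 5 := by positivity
    nlinarith [mul_le_mul_of_nonneg_left hd0 h5]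

lemma kerB (u v t : ℝ) (hu : u ^ 2 = 3 / 5) (hu0 : 0 ≤ u) (hv : v ^ 2 = 1 / 5) (hv0 : 0 ≤ v)
    (ht0 : 0 ≤ t) (ht : t ≤ 1) :
    0 ≤ 5 / 3 * (max (u - t) 0) ^ 5 + 1 / 2 * (1 - t) ^ 5 + 5 / 2 * (max (v - t) 0) ^ 5
      - (1 - t) ^ 6 := by
  have hu1 : 0.774596 ≤ u := by nlinarith
  have hv1 : 0.447213 ≤ v := by nlinarith
  have hv2 : v ≤ 0.4473 := by nlinarith
  rcases le_total (1 / 2) t with h | h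
  · have h1 : 0 ≤ (max (u - t) 0) ^ 5 := by positivity
    have h2 : 0 ≤ (max (v - t) 0) ^ 5 := by positivity
    have h3 : 0 ≤ (1 - t) ^ 5 := pow_nonneg (by linarith) 5
    have h4 : (1 - t) ^ 6 = (1 - t) ^ 5 * (1 - t) := by ring
    nlinarith
  rcases le_total v t with h' | h'
  · have h2 : 0 ≤ (max (v - t) 0) ^ 5 := by positivity
    have h3 : 0 ≤ (1 - t) ^ 5 := pow_nonneg (by linarith) 5
    have h1 : (0.54 * (1 - t)) ^ 5 ≤ (max (u - t) 0) ^ 5 := by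
      apply pow_le_pow_left₀ (by linarith)
      apply le_max_of_le_left
      linarith
    rw [mul_pow] at h1
    have h4 : (1 - t) ^ 6 = (1 - t) ^ 5 * (1 - t) := by ring
    norm_num at h1
    nlinarith
  · have h1 : (0.774596 - t) ^ 5 ≤ (max (u - t) 0) ^ 5 := by
      apply (Odd.strictMono_pow (by decide : Odd 5)).monotone
      apply le_max_of_le_left
      linarith
    have h2 : (0.447213 - t) ^ 5 ≤ (max (v - t) 0) ^ 5 := by
      apply (Odd.strictMono_pow (by decide : Odd 5)).monotone
      apply le_max_of_le_left
      linarith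
    have ht' : t ≤ 0.4473 := by linarith
    have h3 : 0 ≤ 5 / 3 * (0.774596 - t) ^ 5 + 1 / 2 * (1 - t) ^ 5
        + 5 / 2 * (0.447213 - t) ^ 5 - (1 - t) ^ 6 := by
      have e1 : t ^ 2 ≤ 0.4473 ^ 2 := pow_le_pow_left₀ ht0 ht' 2
      have e2 : t ^ 3 ≤ 0.4473 ^ 3 := pow_le_pow_left₀ ht0 ht' 3
      have e3 : 0 ≤ t ^ 2 := by positivity
      have e4 : 0 ≤ t ^ 3 := by positivity
      have w0 : 0 ≤ t * (0.456 - 4 / 3 * t + t ^ 2) := by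
        apply mul_nonneg ht0; nlinarith [sq_nonneg (t - 2/3)]
      have w1 : t * (0.456 - 4 / 3 * t + t ^ 2) ≤ 0.05 := by
        nlinarith [mul_nonneg ht0 (sq_nonneg (t - 0.23)), sq_nonneg (t - 0.23)]
      have w2 : t ^ 3 * (t * (0.456 - 4 / 3 * t + t ^ 2)) ≤ 0.4473 ^ 3 * 0.05 :=
        mul_le_mul e2 w1 w0 (by norm_num)
      have e5 : t ^ 4 ≤ 1 := pow_le_one₀ ht0 ht
      have e6 : 0 ≤ t ^ 4 := by positivity
      ring_nf at w2 e1 e2 ⊢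
      norm_num at w2 e1 e2 ⊢
      linarith
    linarith

section core
variable (G : ℕ → ℝ → ℝ)

lemma tay (hc : ∀ k ≤ 6, ContinuousOn (G k) (Set.Icc 0 1))
    (hd : ∀ k < 6, ∀ t ∈ Set.Ioo (0:ℝ) 1, HasDerivAt (G k) (G (k+1) t) t)
    (h1 : G 1 0 = 0) (h3 : G 3 0 = 0) (h5 : G 5 0 = 0) (x : ℝ) (hx0 : 0 ≤ x) (hx : x ≤ 1) :
    G 0 x = G 0 0 + G 2 0 * x ^ 2 / 2 + G 4 0 * x ^ 4 / 24
      + (∫ t in (0:ℝ)..1, (max (x - t) 0) ^ 5 * G 6 t) / 120 := by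
  have hsub : Set.Icc 0 x ⊆ Set.Icc (0:ℝ) 1 := Set.Icc_subset_Icc_right hx
  have c := fun k hk => (hc k hk).mono hsub
  have c0 := c 0 (by norm_num)
  have c1 := c 1 (by norm_num)
  have c2 := c 2 (by norm_num)
  have c3 := c 3 (by norm_num)
  have c4 := c 4 (by norm_num)
  have c5 := c 5 (by norm_num)
  have c6 := c 6 (by norm_num)
  have H := integral_eq_sub_of_hasDerivAt_of_le (a := 0) (b := x) hx0
    (f := fun t => G 0 t + G 1 t * (x - t) + G 2 t * (x - t) ^ 2 / 2 + G 3 t * (x - t) ^ 3 / 6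
      + G 4 t * (x - t) ^ 4 / 24 + G 5 t * (x - t) ^ 5 / 120)
    (f' := fun t => (x - t) ^ 5 * G 6 t / 120) (by fun_prop)
    (by
      intro t ht
      have ht' : t ∈ Set.Ioo (0:ℝ) 1 := ⟨ht.1, ht.2.trans_le hx⟩
      have d := fun k hk => hd k hk t ht'
      have e : HasDerivAt (fun t => x - t) (-1) t := by
        simpa using (hasDerivAt_id t).const_sub x
      have := (((((d 0 (by norm_num)).add ((d 1 (by norm_num)).mul e)).add
        (((d 2 (by norm_num)).mul (e.pow 2)).div_const 2)).add
        (((d 3 (by norm_num)).mul (e.pow 3)).div_const 6)).add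
        (((d 4 (by norm_num)).mul (e.pow 4)).div_const 24)).add
        (((d 5 (by norm_num)).mul (e.pow 5)).div_const 120)
      refine HasDerivAt.congr_deriv this ?_
      simp
      ring)
    (by
      apply ContinuousOn.intervalIntegrable
      rw [Set.uIcc_of_le hx0]
      fun_prop)
  have hI : ∀ p q : ℝ, 0 ≤ p → p ≤ q → q ≤ 1 →
      IntervalIntegrable (fun t => (max (x - t) 0) ^ 5 * G 6 t) volume p q := by
    intro p q hp hpq hq
    apply ContinuousOn.intervalIntegrable
    rw [Set.uIcc_of_le hpq]
    have := (hc 6 le_rfl).mono (Set.Icc_subset_Icc hp hq)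
    fun_prop
  rw [← integral_add_adjacent_intervals (hI 0 x le_rfl hx0 hx) (hI x 1 hx0 hx le_rfl)]
  have z : (∫ t in x..1, (max (x - t) 0) ^ 5 * G 6 t) = 0 := by
    rw [← integral_zero (a := x) (b := 1) (μ := volume) (E := ℝ)]
    apply integral_congr
    intro t ht
    rw [Set.uIcc_of_le hx] at ht
    simp [max_eq_right (sub_nonpos.2 ht.1)]
  have y : (∫ t in (0:ℝ)..x, (max (x - t) 0) ^ 5 * G 6 t) = ∫ t in (0:ℝ)..x, (x - t) ^ 5 * G 6 t := by
    apply integral_congr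
    intro t ht
    rw [Set.uIcc_of_le hx0] at ht
    simp [max_eq_left (sub_nonneg.2 ht.2)]
  rw [z, y]
  rw [intervalIntegral.integral_div] at H
  simp [h1, h3, h5] at H
  linarith

lemma tayI (hc : ∀ k ≤ 6, ContinuousOn (G k) (Set.Icc 0 1))
    (hd : ∀ k < 6, ∀ t ∈ Set.Ioo (0:ℝ) 1, HasDerivAt (G k) (G (k+1) t) t)
    (h1 : G 1 0 = 0) (h3 : G 3 0 = 0) (h5 : G 5 0 = 0) :
    (∫ t in (0:ℝ)..1, G 0 t) = G 0 0 + G 2 0 / 6 + G 4 0 / 120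
      + (∫ t in (0:ℝ)..1, (1 - t) ^ 6 * G 6 t) / 720 := by
  have c0 := hc 0 (by norm_num)
  have c1 := hc 1 (by norm_num)
  have c2 := hc 2 (by norm_num)
  have c3 := hc 3 (by norm_num)
  have c4 := hc 4 (by norm_num)
  have c5 := hc 5 (by norm_num)
  have c6 := hc 6 (by norm_num)
  have i0 : IntervalIntegrable (G 0) volume 0 1 := by
    apply ContinuousOn.intervalIntegrable
    rwa [Set.uIcc_of_le zero_le_one]
  have i6 : IntervalIntegrable (fun t => (1 - t) ^ 6 * G 6 t / 720) volume 0 1 := by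
    apply ContinuousOn.intervalIntegrable
    rw [Set.uIcc_of_le zero_le_one]
    fun_prop
  have H := integral_eq_sub_of_hasDerivAt_of_le (a := 0) (b := 1) zero_le_one
    (f := fun t => -(G 0 t * (1 - t) + G 1 t * (1 - t) ^ 2 / 2 + G 2 t * (1 - t) ^ 3 / 6
      + G 3 t * (1 - t) ^ 4 / 24
      + G 4 t * (1 - t) ^ 5 / 120 + G 5 t * (1 - t) ^ 6 / 720))
    (f' := fun t => G 0 t - (1 - t) ^ 6 * G 6 t / 720) (by fun_prop)
    (by
      intro t ht
      have d := fun k hk => hd k hk t ht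
      have e : HasDerivAt (fun t : ℝ => 1 - t) (-1) t := by
        simpa using (hasDerivAt_id t).const_sub 1
      have := ((((((d 0 (by norm_num)).mul e).add
        (((d 1 (by norm_num)).mul (e.pow 2)).div_const 2)).add
        (((d 2 (by norm_num)).mul (e.pow 3)).div_const 6)).add
        (((d 3 (by norm_num)).mul (e.pow 4)).div_const 24)).add
        (((d 4 (by norm_num)).mul (e.pow 5)).div_const 120)).add
        (((d 5 (by norm_num)).mul (e.pow 6)).div_const 720)
      refine HasDerivAt.congr_deriv this.neg ?_
      simp
      ring)
    (i0.sub i6)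
  rw [intervalIntegral.integral_sub i0 i6, intervalIntegral.integral_div] at H
  simp [h1, h3, h5] at H
  linarith

lemma core (hc : ∀ k ≤ 6, ContinuousOn (G k) (Set.Icc 0 1))
    (hd : ∀ k < 6, ∀ t ∈ Set.Ioo (0:ℝ) 1, HasDerivAt (G k) (G (k+1) t) t)
    (h1 : G 1 0 = 0) (h3 : G 3 0 = 0) (h5 : G 5 0 = 0)
    (h6 : ∀ t ∈ Set.Icc (0:ℝ) 1, 0 ≤ G 6 t)
    (u v : ℝ) (hu : u ^ 2 = 3 / 5) (hu0 : 0 ≤ u) (hv : v ^ 2 = 1 / 5) (hv0 : 0 ≤ v) :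
    5 / 9 * G 0 u + 4 / 9 * G 0 0 ≤ (∫ t in (0:ℝ)..1, G 0 t) ∧
    (∫ t in (0:ℝ)..1, G 0 t) ≤
      (5 / 9 * G 0 u + 4 / 9 * G 0 0 + (1 / 6 * G 0 1 + 5 / 6 * G 0 v)) / 2 := by
  have hu4 : u ^ 4 = 9 / 25 := by rw [show u ^ 4 = (u ^ 2) ^ 2 by ring, hu]; norm_num
  have hv4 : v ^ 4 = 1 / 25 := by rw [show v ^ 4 = (v ^ 2) ^ 2 by ring, hv]; norm_num
  have Tu := tay G hc hd h1 h3 h5 u hu0 (by nlinarith)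
  have Tv := tay G hc hd h1 h3 h5 v hv0 (by nlinarith)
  have T1 := tay G hc hd h1 h3 h5 1 zero_le_one le_rfl
  have TI := tayI G hc hd h1 h3 h5
  have c6 := hc 6 le_rfl
  have iM : ∀ x : ℝ, IntervalIntegrable (fun t => (max (x - t) 0) ^ 5 * G 6 t) volume 0 1 := by
    intro x
    apply ContinuousOn.intervalIntegrable
    rw [Set.uIcc_of_le zero_le_one]
    fun_prop
  have i6 : IntervalIntegrable (fun t => (1 - t) ^ 6 * G 6 t) volume 0 1 := by
    apply ContinuousOn.intervalIntegrable
    rw [Set.uIcc_of_le zero_le_one]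
    fun_prop
  have PA : 0 ≤ ∫ t in (0:ℝ)..1, ((1 - t) ^ 6 * G 6 t - 10 / 3 * ((max (u - t) 0) ^ 5 * G 6 t)) := by
    apply integral_nonneg zero_le_one
    intro t ht
    have := mul_nonneg (kerA u t hu hu0 ht.2) (h6 t ht)
    linarith
  have PB : 0 ≤ ∫ t in (0:ℝ)..1, (5 / 3 * ((max (u - t) 0) ^ 5 * G 6 t)
      + 1 / 2 * ((max (1 - t) 0) ^ 5 * G 6 t) + 5 / 2 * ((max (v - t) 0) ^ 5 * G 6 t)
      - (1 - t) ^ 6 * G 6 t) := by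
    apply integral_nonneg zero_le_one
    intro t ht
    have := mul_nonneg (kerB u v t hu hu0 hv hv0 ht.1 ht.2) (h6 t ht)
    have e : max (1 - t) 0 = 1 - t := max_eq_left (sub_nonneg.2 ht.2)
    simp only [e]
    linarith
  rw [intervalIntegral.integral_sub i6 ((iM u).const_mul _), intervalIntegral.integral_const_mul] at PA
  rw [intervalIntegral.integral_sub ((((iM u).const_mul _).add ((iM 1).const_mul _)).add
    ((iM v).const_mul _)) i6, intervalIntegral.integral_add
    (((iM u).const_mul _).add ((iM 1).const_mul _)) ((iM v).const_mul _),
    intervalIntegral.integral_add ((iM u).const_mul _) ((iM 1).const_mul _),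
    intervalIntegral.integral_const_mul, intervalIntegral.integral_const_mul,
    intervalIntegral.integral_const_mul] at PB
  rw [hu, hu4] at Tu
  rw [hv, hv4] at Tv
  rw [Tu, Tv, T1, TI]
  constructor <;> linarith

end core

theorem refined_sandwich (a b : ℝ) (hab : a < b) (f : ℝ → ℝ)
    (hf : ContDiffOn ℝ 6 f (Set.Icc a b))
    (hpos : ∀ x ∈ Set.Icc a b, 0 ≤ iteratedDerivWithin 6 f (Set.Icc a b) x) :
    gaussQ f a b ≤ (∫ x in a..b, f x) ∧
      (∫ x in a..b, f x) ≤ (gaussQ f a b + lobattoQ f a b) / 2 := by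
  have hU : UniqueDiffOn ℝ (Set.Icc a b) := uniqueDiffOn_Icc hab
  obtain ⟨F, hF⟩ : ∃ F : ℕ → ℝ → ℝ, F = fun k => iteratedDerivWithin k f (Set.Icc a b) := ⟨_, rfl⟩
  have F0 : F 0 = f := by rw [hF]; simp
  have Fc : ∀ k ≤ 6, ContinuousOn (F k) (Set.Icc a b) := by
    intro k hk
    rw [hF]
    exact hf.continuousOn_iteratedDerivWithin (by exact_mod_cast hk) hU
  have Fd : ∀ k < 6, ∀ x ∈ Set.Ioo a b, HasDerivAt (F k) (F (k+1) x) x := by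
    intro k hk x hx
    have h := (hf.differentiableOn_iteratedDerivWithin (m := k) (by exact_mod_cast hk) hU) x
      (Set.Ioo_subset_Icc_self hx)
    have := h.hasDerivWithinAt.hasDerivAt (Icc_mem_nhds hx.1 hx.2)
    rw [hF]
    simp only [iteratedDerivWithin_succ]
    exact this
  have Fp : ∀ x ∈ Set.Icc a b, 0 ≤ F 6 x := by rw [hF]; exact hpos
  clear hF
  obtain ⟨m, hm⟩ : ∃ m, m = (a + b) / 2 := ⟨_, rfl⟩
  obtain ⟨h, hh⟩ : ∃ h, h = (b - a) / 2 := ⟨_, rfl⟩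
  have hh0 : 0 < h := by rw [hh]; linarith
  have ea : a = m - h := by rw [hm, hh]; ring
  have eb : b = m + h := by rw [hm, hh]; ring
  have mp : ∀ t ∈ Set.Icc (0:ℝ) 1, m + h * t ∈ Set.Icc a b := by
    intro t ht
    rw [ea, eb]; constructor <;> nlinarith [ht.1, ht.2]
  have mn : ∀ t ∈ Set.Icc (0:ℝ) 1, m - h * t ∈ Set.Icc a b := by
    intro t ht
    rw [ea, eb]; constructor <;> nlinarith [ht.1, ht.2]
  have mp' : ∀ t ∈ Set.Ioo (0:ℝ) 1, m + h * t ∈ Set.Ioo a b := by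
    intro t ht
    rw [ea, eb]; constructor <;> nlinarith [ht.1, ht.2]
  have mn' : ∀ t ∈ Set.Ioo (0:ℝ) 1, m - h * t ∈ Set.Ioo a b := by
    intro t ht
    rw [ea, eb]; constructor <;> nlinarith [ht.1, ht.2]
  have cp : ∀ k ≤ 6, ContinuousOn (fun t => F k (m + h * t)) (Set.Icc 0 1) := fun k hk =>
    (Fc k hk).comp (by fun_prop) mp
  have cn : ∀ k ≤ 6, ContinuousOn (fun t => F k (m - h * t)) (Set.Icc 0 1) := fun k hk =>
    (Fc k hk).comp (by fun_prop) mn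
  have s15 : Real.sqrt 15 ^ 2 = 15 := Real.sq_sqrt (by norm_num)
  have s5 : Real.sqrt 5 ^ 2 = 5 := Real.sq_sqrt (by norm_num)
  have C := core (fun k t => h ^ k * (F k (m + h * t) + (-1) ^ k * F k (m - h * t)))
    (by
      intro k hk
      exact continuousOn_const.mul ((cp k hk).add (continuousOn_const.mul (cn k hk))))
    (by
      intro k hk t ht
      have e : HasDerivAt (fun t => h * t) h t := by
        simpa using (hasDerivAt_id t).const_mul h
      have d1 := (Fd k hk _ (mp' t ht)).comp t (e.const_add m)
      have d2 := (Fd k hk _ (mn' t ht)).comp t (e.const_sub m)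
      have := (d1.add (d2.const_mul ((-1) ^ k))).const_mul (h ^ k)
      refine HasDerivAt.congr_deriv this ?_
      ring)
    (by simp) (by simp; right; ring) (by simp; right; ring)
    (by
      intro t ht
      have := Fp _ (mp t ht)
      have := Fp _ (mn t ht)
      norm_num
      positivity)
    (Real.sqrt 15 / 5) (Real.sqrt 5 / 5)
    (by rw [div_pow, s15]; norm_num) (by positivity)
    (by rw [div_pow, s5]; norm_num) (by positivity)
  simp only [F0, pow_zero, one_mul, mul_zero, add_zero, sub_zero, mul_one] at C
  have ip : IntervalIntegrable (fun t => f (m + h * t)) volume 0 1 := by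
    apply ContinuousOn.intervalIntegrable
    rw [Set.uIcc_of_le zero_le_one, ← F0]
    exact cp 0 (by norm_num)
  have iN : IntervalIntegrable (fun t => f (m - h * t)) volume 0 1 := by
    apply ContinuousOn.intervalIntegrable
    rw [Set.uIcc_of_le zero_le_one, ← F0]
    exact cn 0 (by norm_num)
  have fi : ∀ p q : ℝ, a ≤ p → p ≤ q → q ≤ b → IntervalIntegrable f volume p q := by
    intro p q hp hpq hq
    apply ContinuousOn.intervalIntegrable
    rw [Set.uIcc_of_le hpq]
    exact hf.continuousOn.mono (Set.Icc_subset_Icc hp hq)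
  have J : (∫ x in a..b, f x) = h * ∫ t in (0:ℝ)..1, (f (m + h * t) + f (m - h * t)) := by
    rw [intervalIntegral.integral_add ip iN,
      intervalIntegral.integral_comp_add_mul _ hh0.ne', intervalIntegral.integral_comp_sub_mul _ hh0.ne',
      ← integral_add_adjacent_intervals (fi a m le_rfl (by linarith) (by linarith))
        (fi m b (by linarith) (by linarith) le_rfl)]
    simp only [mul_zero, mul_one, add_zero, sub_zero, smul_eq_mul, ← ea, ← eb]
    field_simp
    ring
  have n1 : (5 + Real.sqrt 15) / 10 * a + (5 - Real.sqrt 15) / 10 * b = m - h * (Real.sqrt 15 / 5) := by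
    rw [ea, eb]; ring
  have n2 : (5 - Real.sqrt 15) / 10 * a + (5 + Real.sqrt 15) / 10 * b = m + h * (Real.sqrt 15 / 5) := by
    rw [ea, eb]; ring
  have n3 : (5 + Real.sqrt 5) / 10 * a + (5 - Real.sqrt 5) / 10 * b = m - h * (Real.sqrt 5 / 5) := by
    rw [ea, eb]; ring
  have n4 : (5 - Real.sqrt 5) / 10 * a + (5 + Real.sqrt 5) / 10 * b = m + h * (Real.sqrt 5 / 5) := by
    rw [ea, eb]; ring
  have hba : b - a = 2 * h := by rw [hh]; ring
  rw [J]
  unfold gaussQ lobattoQ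
  rw [n1, n2, n3, n4, ← hm, hba]
  rw [← ea, ← eb] at C
  have C1 := mul_le_mul_of_nonneg_left C.1 hh0.le
  have C2 := mul_le_mul_of_nonneg_left C.2 hh0.le
  constructor <;> linarith
end

section
/- For f : [a,b] → ℝ of class C^6, the composite four-point Lobatto quadrature satisfies |∫_a^b f(x) dx − L_n[f;a,b]| ≤ (b−a)^7/(1512000 n^6) · sup_{x∈[a,b]} |f⁽⁶⁾(x)|. -/
open MeasureTheory intervalIntegral

noncomputable def gaussC (n : ℕ) (f : ℝ → ℝ) (a b : ℝ) : ℝ :=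
  ∑ k ∈ Finset.range n, gaussQ f (a + k * (b - a) / n) (a + (k + 1) * (b - a) / n)

noncomputable def lobattoC (n : ℕ) (f : ℝ → ℝ) (a b : ℝ) : ℝ :=
  ∑ k ∈ Finset.range n, lobattoQ f (a + k * (b - a) / n) (a + (k + 1) * (b - a) / n)

noncomputable def quadC (n : ℕ) (f : ℝ → ℝ) (a b : ℝ) : ℝ :=
  ∑ k ∈ Finset.range n, quadQ f (a + k * (b - a) / n) (a + (k + 1) * (b - a) / n)

/-- Chain of successive derivatives of the antiderivative of a monic sextic over 720. -/
noncomputable def pch (c5 c4 c3 c2 c1 c0 : ℝ) : ℕ → ℝ → ℝ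
  | 0 => fun x => (x^7/7 + c5*x^6/6 + c4*x^5/5 + c3*x^4/4 + c2*x^3/3 + c1*x^2/2 + c0*x)/720
  | 1 => fun x => (x^6 + c5*x^5 + c4*x^4 + c3*x^3 + c2*x^2 + c1*x + c0)/720
  | 2 => fun x => (6*x^5 + 5*c5*x^4 + 4*c4*x^3 + 3*c3*x^2 + 2*c2*x + c1)/720
  | 3 => fun x => (30*x^4 + 20*c5*x^3 + 12*c4*x^2 + 6*c3*x + 2*c2)/720
  | 4 => fun x => (120*x^3 + 60*c5*x^2 + 24*c4*x + 6*c3)/720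
  | 5 => fun x => (360*x^2 + 120*c5*x + 24*c4)/720
  | 6 => fun x => (720*x + 120*c5)/720
  | 7 => fun _ => 1
  | _ => fun _ => 0

lemma poly7_hasDerivAt (a7 a6 a5 a4 a3 a2 a1 a0 x : ℝ) :
    HasDerivAt (fun x : ℝ => a7*x^7 + a6*x^6 + a5*x^5 + a4*x^4 + a3*x^3 + a2*x^2 + a1*x + a0)
      (7*a7*x^6 + 6*a6*x^5 + 5*a5*x^4 + 4*a4*x^3 + 3*a3*x^2 + 2*a2*x + a1) x := by
  have h := ((((((((hasDerivAt_pow 7 x).const_mul a7).add ((hasDerivAt_pow 6 x).const_mul a6)).add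
    ((hasDerivAt_pow 5 x).const_mul a5)).add ((hasDerivAt_pow 4 x).const_mul a4)).add
    ((hasDerivAt_pow 3 x).const_mul a3)).add ((hasDerivAt_pow 2 x).const_mul a2)).add
    ((hasDerivAt_id x).const_mul a1)).add_const a0
  refine (h.congr_deriv ?_).congr_of_eventuallyEq ?_
  · push_cast; ring
  · exact Filter.Eventually.of_forall fun y => by simp

lemma pch_deriv (c5 c4 c3 c2 c1 c0 : ℝ) (k : ℕ) (x : ℝ) :
    HasDerivAt (pch c5 c4 c3 c2 c1 c0 k) (pch c5 c4 c3 c2 c1 c0 (k+1) x) x := by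
  match k with
  | 0 =>
    refine ((poly7_hasDerivAt (1/7/720) (c5/6/720) (c4/5/720) (c3/4/720) (c2/3/720) (c1/2/720)
      (c0/720) 0 x).congr_deriv ?_).congr_of_eventuallyEq (Filter.Eventually.of_forall fun y => ?_)
    all_goals simp only [pch]; ring
  | 1 =>
    refine ((poly7_hasDerivAt 0 (1/720) (c5/720) (c4/720) (c3/720) (c2/720) (c1/720)
      (c0/720) x).congr_deriv ?_).congr_of_eventuallyEq (Filter.Eventually.of_forall fun y => ?_)
    all_goals simp only [pch]; ring
  | 2 =>
    refine ((poly7_hasDerivAt 0 0 (6/720) (5*c5/720) (4*c4/720) (3*c3/720) (2*c2/720) (c1/720)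
      x).congr_deriv ?_).congr_of_eventuallyEq (Filter.Eventually.of_forall fun y => ?_)
    all_goals simp only [pch]; ring
  | 3 =>
    refine ((poly7_hasDerivAt 0 0 0 (30/720) (20*c5/720) (12*c4/720) (6*c3/720) (2*c2/720)
      x).congr_deriv ?_).congr_of_eventuallyEq (Filter.Eventually.of_forall fun y => ?_)
    all_goals simp only [pch]; ring
  | 4 =>
    refine ((poly7_hasDerivAt 0 0 0 0 (120/720) (60*c5/720) (24*c4/720) (6*c3/720)
      x).congr_deriv ?_).congr_of_eventuallyEq (Filter.Eventually.of_forall fun y => ?_)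
    all_goals simp only [pch]; ring
  | 5 =>
    refine ((poly7_hasDerivAt 0 0 0 0 0 (360/720) (120*c5/720) (24*c4/720)
      x).congr_deriv ?_).congr_of_eventuallyEq (Filter.Eventually.of_forall fun y => ?_)
    all_goals simp only [pch]; ring
  | 6 =>
    refine ((poly7_hasDerivAt 0 0 0 0 0 0 (720/720) (120*c5/720)
      x).congr_deriv ?_).congr_of_eventuallyEq (Filter.Eventually.of_forall fun y => ?_)
    all_goals simp only [pch]; ring
  | 7 => exact hasDerivAt_const x (1:ℝ)
  | (n+8) => exact hasDerivAt_const x (0:ℝ)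

/-- Boundary terms of the six-fold integration by parts. -/
noncomputable def bdry (P g : ℕ → ℝ → ℝ) (x : ℝ) : ℝ :=
  P 6 x * g 0 x - P 5 x * g 1 x + P 4 x * g 2 x - P 3 x * g 3 x + P 2 x * g 4 x - P 1 x * g 5 x

lemma ibp (P g : ℕ → ℝ → ℝ) (u v M : ℝ) (huv : u ≤ v)
    (hP : ∀ k x, HasDerivAt (P k) (P (k+1) x) x) (hP7 : ∀ x, P 7 x = 1)
    (hneg : ∀ x ∈ Set.Icc u v, P 1 x ≤ 0)
    (hgc : ∀ k ≤ 6, ContinuousOn (g k) (Set.Icc u v))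
    (hgd : ∀ k < 6, ∀ x ∈ Set.Ioo u v, HasDerivAt (g k) (g (k+1) x) x)
    (hM : ∀ x ∈ Set.Icc u v, |g 6 x| ≤ M) :
    |(∫ x in u..v, g 0 x) - (bdry P g v - bdry P g u)| ≤ M * (P 0 u - P 0 v) := by
  have hPc : ∀ k, Continuous (P k) := fun k =>
    continuous_iff_continuousAt.2 fun x => (hP k x).continuousAt
  have hPo : ∀ k, ContinuousOn (P k) (Set.Icc u v) := fun k => (hPc k).continuousOn
  have hu : Set.uIcc u v = Set.Icc u v := Set.uIcc_of_le huv
  have i0 : IntervalIntegrable (g 0) volume u v :=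
    ContinuousOn.intervalIntegrable (by rw [hu]; exact hgc 0 (by norm_num))
  have c6 : ContinuousOn (fun x => P 1 x * g 6 x) (Set.Icc u v) :=
    (hPo 1).mul (hgc 6 le_rfl)
  have i6 : IntervalIntegrable (fun x => P 1 x * g 6 x) volume u v :=
    ContinuousOn.intervalIntegrable (by rw [hu]; exact c6)
  have key : ∫ x in u..v, (g 0 x - P 1 x * g 6 x) = bdry P g v - bdry P g u := by
    refine integral_eq_sub_of_hasDerivAt_of_le huv ?_ ?_ (i0.sub i6)
    · have t : ∀ i k, k ≤ 6 → ContinuousOn (fun x => P i x * g k x) (Set.Icc u v) :=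
        fun i k hk => (hPo i).mul (hgc k hk)
      exact (((((t 6 0 (by norm_num)).sub (t 5 1 (by norm_num))).add (t 4 2 (by norm_num))).sub
        (t 3 3 (by norm_num))).add (t 2 4 (by norm_num))).sub (t 1 5 (by norm_num))
    · intro x hx
      have t : ∀ i k, k < 6 → HasDerivAt (fun x => P i x * g k x)
          (P (i+1) x * g k x + P i x * g (k+1) x) x :=
        fun i k hk => (hP i x).mul (hgd k hk x hx)
      have h := (((((t 6 0 (by norm_num)).sub (t 5 1 (by norm_num))).add (t 4 2 (by norm_num))).sub
        (t 3 3 (by norm_num))).add (t 2 4 (by norm_num))).sub (t 1 5 (by norm_num))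
      refine HasDerivAt.congr_deriv (f := bdry P g) h ?_
      norm_num [hP7]
      ring
  rw [← key, ← integral_sub i0 (i0.sub i6)]
  have e : ∫ x in u..v, -P 1 x * M = M * (P 0 u - P 0 v) := by
    have h1 : ∫ x in u..v, P 1 x = P 0 v - P 0 u :=
      integral_eq_sub_of_hasDerivAt (fun x _ => hP 0 x) ((hPc 1).intervalIntegrable _ _)
    rw [intervalIntegral.integral_mul_const, intervalIntegral.integral_neg, h1]; ring
  rw [← e, ← Real.norm_eq_abs]
  refine norm_integral_le_of_norm_le huv ?_ (((hPc 1).neg.mul continuous_const).intervalIntegrable _ _)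
  refine Filter.Eventually.of_forall fun x hx => ?_
  have hx' : x ∈ Set.Icc u v := ⟨hx.1.le, hx.2⟩
  have h2 := hneg x hx'
  rw [sub_sub_cancel, Real.norm_eq_abs, abs_mul, abs_of_nonpos h2]
  exact mul_le_mul_of_nonneg_left (hM x hx') (by linarith)

lemma unit_panel (g : ℕ → ℝ → ℝ) (M s : ℝ) (hs0 : 0 < s) (hs : s^2 = 1/5)
    (hgc : ∀ k ≤ 6, ContinuousOn (g k) (Set.Icc (-1) 1))
    (hgd : ∀ k < 6, ∀ x ∈ Set.Ioo (-1:ℝ) 1, HasDerivAt (g k) (g (k+1) x) x)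
    (hM : ∀ x ∈ Set.Icc (-1:ℝ) 1, |g 6 x| ≤ M) :
    |(∫ x in (-1:ℝ)..1, g 0 x) - 1/6 * (g 0 (-1) + 5 * g 0 (-s) + 5 * g 0 s + g 0 1)|
      ≤ M * (2/23625) := by
  have hs1 : s < 9/20 := by nlinarith
  have hs2 : 11/25 < s := by nlinarith
  have s3 : s^3 = s/5 := by rw [pow_succ, hs]; ring
  have s4 : s^4 = 1/25 := by rw [show s^4 = (s^2)^2 by ring, hs]; norm_num
  have s5 : s^5 = s/25 := by rw [pow_succ, s4]; ring
  have s6 : s^6 = 1/125 := by rw [show s^6 = (s^2)^3 by ring, hs]; norm_num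
  have s7 : s^7 = s/125 := by rw [pow_succ, s6]; ring
  have s8 : s^8 = 1/625 := by rw [show s^8 = (s^2)^4 by ring, hs]; norm_num
  have hii : ∀ u v, -1 ≤ u → u ≤ v → v ≤ 1 → IntervalIntegrable (g 0) volume u v := by
    intro u v h1 h2 h3
    apply ContinuousOn.intervalIntegrable
    rw [Set.uIcc_of_le h2]
    exact (hgc 0 (by norm_num)).mono (Set.Icc_subset_Icc h1 h3)
  have step : ∀ u v c5 c4 c3 c2 c1 c0, -1 ≤ u → u ≤ v → v ≤ 1 →
      (∀ x ∈ Set.Icc u v, pch c5 c4 c3 c2 c1 c0 1 x ≤ 0) →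
      |(∫ x in u..v, g 0 x) - (bdry (pch c5 c4 c3 c2 c1 c0) g v - bdry (pch c5 c4 c3 c2 c1 c0) g u)|
        ≤ M * (pch c5 c4 c3 c2 c1 c0 0 u - pch c5 c4 c3 c2 c1 c0 0 v) := by
    intro u v c5 c4 c3 c2 c1 c0 h1 h2 h3 h4
    exact ibp _ g u v M h2 (pch_deriv _ _ _ _ _ _) (fun _ => rfl) h4
      (fun k hk => (hgc k hk).mono (Set.Icc_subset_Icc h1 h3))
      (fun k hk x hx => hgd k hk x (Set.Ioo_subset_Ioo h1 h3 hx))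
      (fun x hx => hM x (Set.Icc_subset_Icc h1 h3 hx))
  have A := step (-1) (-s) 5 10 10 5 1 0 le_rfl (by linarith) (by linarith) (by
    rintro x ⟨h1, h2⟩
    simp only [pch]
    have : 0 ≤ (x+1)^5 := pow_nonneg (by linarith) 5
    nlinarith [mul_nonneg this (by linarith : 0 ≤ -x)])
  have C := step s 1 (-5) 10 (-10) 5 (-1) 0 (by linarith) (by linarith) le_rfl (by
    rintro x ⟨h1, h2⟩
    simp only [pch]
    have : 0 ≤ (1-x)^5 := pow_nonneg (by linarith) 5
    nlinarith [mul_nonneg this (by linarith : 0 ≤ x)])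
  have B := step (-s) s 0 (10-25*s) 0 (5-10*s) 0 (-s/5) (by linarith) (by linarith) (by linarith) (by
    rintro x ⟨h1, h2⟩
    simp only [pch]
    have hy : x^2 ≤ 1/5 := by rw [← hs]; nlinarith
    have hy0 := sq_nonneg x
    -- at the endpoint the value is nonpositive, and the cubic in x^2 is increasing
    have q : 0 ≤ (x^2)^2 + (1/5 + (10-25*s))*x^2 + (1/25 + (10-25*s)/5 + (5-10*s)) := by
      nlinarith [sq_nonneg (x^2 - 1/2), sq_nonneg (x^2-1/5)]
    have := mul_nonneg (sub_nonneg.2 hy) q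
    nlinarith)
  have split : (∫ x in (-1:ℝ)..1, g 0 x) = (∫ x in (-1:ℝ)..(-s), g 0 x) + (∫ x in (-s)..s, g 0 x)
      + ∫ x in s..1, g 0 x := by
    rw [integral_add_adjacent_intervals (hii _ _ le_rfl (by linarith) (by linarith))
      (hii _ _ (by linarith) (by linarith) (by linarith)),
      integral_add_adjacent_intervals (hii _ _ le_rfl (by linarith) (by linarith))
      (hii _ _ (by linarith) (by linarith) (by linarith))]
  rw [split]
  set I1 := ∫ x in (-1:ℝ)..(-s), g 0 x
  set I2 := ∫ x in (-s)..s, g 0 x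
  set I3 := ∫ x in s..1, g 0 x
  have E1 : bdry (pch 5 10 10 5 1 0) g (-1) = - (1/6) * g 0 (-1) := by
    simp only [bdry, pch]; ring
  have E2 : bdry (pch (-5) 10 (-10) 5 (-1) 0) g 1 = (1/6) * g 0 1 := by
    simp only [bdry, pch]; ring
  have E3 : bdry (pch 5 10 10 5 1 0) g (-s) -
      bdry (pch 0 (10-25*s) 0 (5-10*s) 0 (-s/5)) g (-s) = 5/6 * g 0 (-s) := by
    simp only [bdry, pch]; ring_nf; simp only [hs, s3, s4, s5, s6]; ring
  have E4 : bdry (pch 0 (10-25*s) 0 (5-10*s) 0 (-s/5)) g s -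
      bdry (pch (-5) 10 (-10) 5 (-1) 0) g s = 5/6 * g 0 s := by
    simp only [bdry, pch]; ring_nf; simp only [hs, s3, s4, s5, s6]; ring
  have E5 : (pch 5 10 10 5 1 0 0 (-1) - pch 5 10 10 5 1 0 0 (-s)) +
      (pch 0 (10-25*s) 0 (5-10*s) 0 (-s/5) 0 (-s) - pch 0 (10-25*s) 0 (5-10*s) 0 (-s/5) 0 s) +
      (pch (-5) 10 (-10) 5 (-1) 0 0 s - pch (-5) 10 (-10) 5 (-1) 0 0 1) = 2/23625 := by
    simp only [pch]; ring_nf; simp only [hs, s3, s4, s5, s6, s7]; ring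
  rw [← E5, mul_add, mul_add]
  rw [abs_le] at A B C ⊢
  constructor <;> linarith [A.1, A.2, B.1, B.2, C.1, C.2]

lemma panel (a b : ℝ) (hab : a < b) (f : ℝ → ℝ) (hf : ContDiffOn ℝ 6 f (Set.Icc a b)) (M : ℝ)
    (hM : ∀ x ∈ Set.Icc a b, |iteratedDerivWithin 6 f (Set.Icc a b) x| ≤ M)
    (c d : ℝ) (hac : a ≤ c) (hcd : c < d) (hdb : d ≤ b) :
    |(∫ x in c..d, f x) - lobattoQ f c d| ≤ (d - c)^7 / 1512000 * M := by
  have hud : UniqueDiffOn ℝ (Set.Icc a b) := uniqueDiffOn_Icc hab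
  obtain ⟨h, hh⟩ : ∃ h, h = (d - c)/2 := ⟨_, rfl⟩
  obtain ⟨m, hm⟩ : ∃ m, m = (c + d)/2 := ⟨_, rfl⟩
  have hpos : 0 < h := by linarith
  let F : ℕ → ℝ → ℝ := fun k => iteratedDerivWithin k f (Set.Icc a b)
  let g : ℕ → ℝ → ℝ := fun k t => h^k * F k (m + h*t)
  have maps : ∀ t ∈ Set.Icc (-1:ℝ) 1, m + h*t ∈ Set.Icc a b := by
    rintro t ⟨h1, h2⟩
    constructor <;> nlinarith
  have maps' : ∀ t ∈ Set.Ioo (-1:ℝ) 1, m + h*t ∈ Set.Ioo a b := by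
    rintro t ⟨h1, h2⟩
    constructor <;> nlinarith
  have s5 : (Real.sqrt 5)^2 = 5 := Real.sq_sqrt (by norm_num)
  have s5p : 0 < Real.sqrt 5 := Real.sqrt_pos.2 (by norm_num)
  have U := unit_panel g (h^6 * M) (Real.sqrt 5 / 5) (by positivity)
    (by rw [div_pow, s5]; norm_num)
    (by
      intro k hk
      have hc : ContinuousOn (F k) (Set.Icc a b) :=
        hf.continuousOn_iteratedDerivWithin (by exact_mod_cast hk) hud
      exact continuousOn_const.mul (hc.comp (by fun_prop) maps))
    (by
      intro k hk x hx
      have hd : DifferentiableOn ℝ (F k) (Set.Icc a b) :=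
        hf.differentiableOn_iteratedDerivWithin (by exact_mod_cast hk) hud
      have hx' := maps' x hx
      have hn : Set.Icc a b ∈ nhds (m + h*x) := Icc_mem_nhds hx'.1 hx'.2
      have h1 : HasDerivAt (F k) (F (k+1) (m + h*x)) (m + h*x) := by
        have := (hd _ (Set.Ioo_subset_Icc_self hx')).hasDerivWithinAt.hasDerivAt hn
        simpa only [F, iteratedDerivWithin_succ] using this
      have h2 : HasDerivAt (fun t => m + h*t) h x := by
        simpa using ((hasDerivAt_id x).const_mul h).const_add m
      have h3 := (h1.comp x h2).const_mul (h^k)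
      exact h3.congr_deriv (by simp only [g]; ring))
    (by
      intro x hx
      simp only [g]
      rw [abs_mul, abs_of_pos (by positivity : 0 < h^6)]
      exact mul_le_mul_of_nonneg_left (hM _ (maps x hx)) (by positivity))
  have hF0 : ∀ t, g 0 t = f (m + h*t) := by intro t; simp [g, F]
  simp only [hF0] at U
  have hint : (∫ x in c..d, f x) = h * ∫ t in (-1:ℝ)..1, f (m + h*t) := by
    have := intervalIntegral.mul_integral_comp_add_mul (a := (-1:ℝ)) (b := 1) (f := f) h m
    rw [this]; congr 1 <;> rw [hm, hh] <;> ring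
  have hl : lobattoQ f c d = h * (1/6 * (f (m + h*(-1)) + 5 * f (m + h*(-(Real.sqrt 5/5)))
      + 5 * f (m + h*(Real.sqrt 5/5)) + f (m + h*1))) := by
    unfold lobattoQ
    rw [show m + h*(-1) = c by rw [hm, hh]; ring, show m + h*1 = d by rw [hm, hh]; ring,
      show m + h*(-(Real.sqrt 5/5)) = (5 + Real.sqrt 5) / 10 * c + (5 - Real.sqrt 5) / 10 * d by
        rw [hm, hh]; ring,
      show m + h*(Real.sqrt 5/5) = (5 - Real.sqrt 5) / 10 * c + (5 + Real.sqrt 5) / 10 * d by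
        rw [hm, hh]; ring, hh]
    ring
  rw [hint, hl, ← mul_sub, abs_mul, abs_of_pos hpos]
  refine (mul_le_mul_of_nonneg_left U hpos.le).trans (le_of_eq ?_)
  rw [hh]; ring

theorem composite_lobatto_error (a b : ℝ) (hab : a < b) (f : ℝ → ℝ)
    (hf : ContDiffOn ℝ 6 f (Set.Icc a b)) (n : ℕ) (hn : 1 ≤ n) :
    |(∫ x in a..b, f x) - lobattoC n f a b| ≤
      (b - a) ^ 7 / (1512000 * n ^ 6) * ⨆ x : Set.Icc a b, |iteratedDerivWithin 6 f (Set.Icc a b) x| := by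
  set M := ⨆ x : Set.Icc a b, |iteratedDerivWithin 6 f (Set.Icc a b) x| with hMdef
  have hM : ∀ x ∈ Set.Icc a b, |iteratedDerivWithin 6 f (Set.Icc a b) x| ≤ M := by
    have hc : ContinuousOn (fun x => |iteratedDerivWithin 6 f (Set.Icc a b) x|) (Set.Icc a b) :=
      (hf.continuousOn_iteratedDerivWithin le_rfl (uniqueDiffOn_Icc hab)).abs
    have hb := isCompact_Icc.bddAbove_image hc
    rw [Set.image_eq_range] at hb
    intro x hx
    exact le_ciSup hb ⟨x, hx⟩
  have hn0 : (0:ℝ) < n := by exact_mod_cast hn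
  let x : ℕ → ℝ := fun k => a + k * (b - a) / n
  have hx0 : x 0 = a := by simp [x]
  have hxn : x n = b := by simp only [x]; field_simp; ring
  have hstep : ∀ k, x (k+1) - x k = (b-a)/n := by
    intro k; simp only [x]; push_cast; field_simp; ring
  have hpos : 0 < (b-a)/n := div_pos (by linarith) hn0
  have hlt : ∀ k, x k < x (k+1) := fun k => by linarith [hstep k]
  have hmono : Monotone x := monotone_nat_of_le_succ fun k => (hlt k).le
  have hsum : (∫ y in a..b, f y) = ∑ k ∈ Finset.range n, ∫ y in x k..x (k+1), f y := by
    rw [intervalIntegral.sum_integral_adjacent_intervals, hx0, hxn]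
    intro k hk
    apply ContinuousOn.intervalIntegrable
    rw [Set.uIcc_of_le (hlt k).le]
    refine hf.continuousOn.mono (Set.Icc_subset_Icc ?_ ?_)
    · rw [← hx0]; exact hmono (Nat.zero_le _)
    · rw [← hxn]; exact hmono hk
  have hL : lobattoC n f a b = ∑ k ∈ Finset.range n, lobattoQ f (x k) (x (k+1)) := by
    simp [lobattoC, x]
  rw [hsum, hL, ← Finset.sum_sub_distrib]
  refine (Finset.abs_sum_le_sum_abs _ _).trans ?_
  have : ∀ k ∈ Finset.range n, |(∫ y in x k..x (k+1), f y) - lobattoQ f (x k) (x (k+1))|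
      ≤ ((b-a)/n)^7 / 1512000 * M := by
    intro k hk
    rw [← hstep k]
    refine panel a b hab f hf M hM _ _ ?_ (hlt k) ?_
    · rw [← hx0]; exact hmono (Nat.zero_le _)
    · rw [← hxn]; exact hmono (Finset.mem_range.1 hk)
  refine (Finset.sum_le_sum this).trans (le_of_eq ?_)
  rw [Finset.sum_const, Finset.card_range, nsmul_eq_mul]
  field_simp
end
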